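/- arXiv:0902.0779 — 2 statements merged into one kernel-verified Lean document; each statement's English description precedes it below -/
import Mathlib

section
/- Let k be a commutative ring and A = k[ℤ²] the group algebra of ℤ², and for m ∈ ℤ², n ∈ Hom(ℤ²,ℤ) let z^m∂_n be the derivation z^{m'} ↦ ⟨m',n⟩·z^{m+m'}. If m, m' ∈ ℤ² are nonzero and n, n' ∈ Hom(ℤ²,ℤ) satisfy ⟨m,n⟩ = 0 and ⟨m',n'⟩ = 0, then ⁅z^m∂_n, z^{m'}∂_{n'}⁆ = z^{m+m'}∂_{n''} where n'' = ⟨m',n⟩n' − ⟨m,n'⟩n satisfies ⟨m+m', n''⟩ = 0; moreover, if m+m' = 0 then n'' = 0, so the bracket vanishes. Consequently the k-submodule of derivations spanned by {z^m∂_n : m ∈ ℤ²∖{0}, ⟨m,n⟩ = 0} is closed under the commutator bracket (it is the Lie algebra 𝔥 underlying the tropical vertex group). -/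
/-!
STATEMENT 3: For m, m' ≠ 0 with ⟨m,n⟩ = 0 and ⟨m',n'⟩ = 0, the bracket
⁅z^m∂_n, z^{m'}∂_{n'}⁆ equals z^{m+m'}∂_{n''} with n'' = ⟨m',n⟩n' − ⟨m,n'⟩n and
⟨m+m',n''⟩ = 0; if m+m' = 0 then n'' = 0 and the bracket vanishes.  Consequently
the k-span of such derivations is closed under the bracket (the Lie algebra 𝔥).
-/

set_option synthInstance.maxHeartbeats 1000000
set_option maxHeartbeats 1000000

noncomputable section

/-- The set of `k`-linear endomorphisms of `k[ℤ²]` of the form `z^m∂_n` with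
`m ≠ 0` and `⟨m,n⟩ = 0`, described by their values on the basis. -/
def hamiltonianSet (k : Type*) [CommRing k] :
    Set (Module.End k (AddMonoidAlgebra k (ℤ × ℤ))) :=
  {D | ∃ (m : ℤ × ℤ) (n : (ℤ × ℤ) →ₗ[ℤ] ℤ), m ≠ 0 ∧ n m = 0 ∧
    ∀ x : ℤ × ℤ,
      D (AddMonoidAlgebra.single x 1) = AddMonoidAlgebra.single (m + x) ((n x : ℤ) : k)}

open AddMonoidAlgebra in
/-- An endomorphism given by `z^x ↦ ⟨x,n⟩ z^{m+x}` on the basis, evaluated on a monomial. -/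
theorem apply_single_of_apply_basis {k M : Type*} [CommRing k] [AddCommGroup M]
    {D : Module.End k (AddMonoidAlgebra k M)} {m : M} {n : M →ₗ[ℤ] ℤ}
    (hD : ∀ x, D (single x 1) = single (m + x) ((n x : ℤ) : k)) (x : M) (c : k) :
    D (single x c) = single (m + x) (c * ((n x : ℤ) : k)) := by
  have h : (single x c : AddMonoidAlgebra k M) = c • single x 1 := by simp
  rw [h, map_smul, hD]
  simp

open AddMonoidAlgebra in
/-- The commutator of `z^m∂_n` and `z^{m'}∂_{n'}` on the basis. -/
theorem lie_apply_basis {k M : Type*} [CommRing k] [AddCommGroup M]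
    {D D' : Module.End k (AddMonoidAlgebra k M)} {m m' : M} {n n' : M →ₗ[ℤ] ℤ}
    (hD : ∀ x, D (single x 1) = single (m + x) ((n x : ℤ) : k))
    (hD' : ∀ x, D' (single x 1) = single (m' + x) ((n' x : ℤ) : k)) (x : M) :
    ⁅D, D'⁆ (single x 1) =
      single (m + m' + x) (((n m' • n' - n' m • n) x : ℤ) : k) := by
  rw [Ring.lie_def, LinearMap.sub_apply, Module.End.mul_apply, Module.End.mul_apply, hD, hD',
    apply_single_of_apply_basis hD, apply_single_of_apply_basis hD',
    show m' + (m + x) = m + m' + x by abel, ← add_assoc, ← single_sub]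
  congr 1
  simp only [map_add, LinearMap.sub_apply, LinearMap.smul_apply, smul_eq_mul]
  push_cast
  ring

/-- Two endomorphisms of a monoid algebra agreeing on the basis are equal. -/
theorem end_ext_basis {k M : Type*} [CommRing k]
    {D D' : Module.End k (AddMonoidAlgebra k M)}
    (h : ∀ x, D (AddMonoidAlgebra.single x 1) = D' (AddMonoidAlgebra.single x 1)) :
    D = D' := by
  ext x : 2
  exact h x

/-- The covector of the commutator annihilates `m + m'`. -/
theorem bracket_covector_apply_add {M : Type*} [AddCommGroup M] {m m' : M} {n n' : M →ₗ[ℤ] ℤ}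
    (hn : n m = 0) (hn' : n' m' = 0) : (n m' • n' - n' m • n) (m + m') = 0 := by
  simp [hn, hn', mul_comm]

/-- The covector of the commutator vanishes when `m + m' = 0`. -/
theorem bracket_covector_eq_zero {M : Type*} [AddCommGroup M] {m m' : M} {n n' : M →ₗ[ℤ] ℤ}
    (hn : n m = 0) (hn' : n' m' = 0) (h : m + m' = 0) : n m' • n' - n' m • n = 0 := by
  obtain rfl : m' = -m := (neg_eq_of_add_eq_zero_right h).symm
  have h' : n' m = 0 := by simpa using hn'
  simp [hn, h']

/-- If `m + m' = 0`, the derivations `z^m∂_n` and `z^{m'}∂_{n'}` commute. -/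
theorem lie_eq_zero_of_add_eq_zero {k M : Type*} [CommRing k] [AddCommGroup M]
    {D D' : Module.End k (AddMonoidAlgebra k M)} {m m' : M} {n n' : M →ₗ[ℤ] ℤ}
    (hn : n m = 0) (hn' : n' m' = 0)
    (hD : ∀ x, D (AddMonoidAlgebra.single x 1) =
      AddMonoidAlgebra.single (m + x) ((n x : ℤ) : k))
    (hD' : ∀ x, D' (AddMonoidAlgebra.single x 1) =
      AddMonoidAlgebra.single (m' + x) ((n' x : ℤ) : k))
    (h : m + m' = 0) : ⁅D, D'⁆ = 0 := by
  refine end_ext_basis fun x => ?_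
  rw [lie_apply_basis hD hD', bracket_covector_eq_zero hn hn' h]
  simp

/-- The bracket of two elements of `hamiltonianSet k` lies in its span. -/
theorem lie_mem_span_hamiltonianSet {k : Type*} [CommRing k]
    {D D' : Module.End k (AddMonoidAlgebra k (ℤ × ℤ))}
    (hD : D ∈ hamiltonianSet k) (hD' : D' ∈ hamiltonianSet k) :
    ⁅D, D'⁆ ∈ Submodule.span k (hamiltonianSet k) := by
  obtain ⟨m, n, -, hn, hD⟩ := hD
  obtain ⟨m', n', -, hn', hD'⟩ := hD'
  by_cases h : m + m' = 0
  · rw [lie_eq_zero_of_add_eq_zero hn hn' hD hD' h]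
    exact zero_mem _
  · exact Submodule.subset_span
      ⟨m + m', _, h, bracket_covector_apply_add hn hn', lie_apply_basis hD hD'⟩

/-- The span of a set in an associative algebra is closed under the commutator as soon as it
contains the commutators of elements of the set. -/
theorem lie_mem_span_of_forall_mem {k A : Type*} [CommRing k] [Ring A] [Algebra k A] {S : Set A}
    (hS : ∀ x ∈ S, ∀ y ∈ S, ⁅x, y⁆ ∈ Submodule.span k S) {E E' : A}
    (hE : E ∈ Submodule.span k S) (hE' : E' ∈ Submodule.span k S) :
    ⁅E, E'⁆ ∈ Submodule.span k S := by
  induction hE, hE' using Submodule.span_induction₂ with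
  | mem_mem x y hx hy => exact hS x hx y hy
  | zero_left y hy => simp [Ring.lie_def]
  | zero_right x hx => simp [Ring.lie_def]
  | add_left x y z _ _ _ h₁ h₂ =>
    have h : ⁅x + y, z⁆ = ⁅x, z⁆ + ⁅y, z⁆ := by simp only [Ring.lie_def]; noncomm_ring
    exact h ▸ add_mem h₁ h₂
  | add_right x y z _ _ _ h₁ h₂ =>
    have h : ⁅x, y + z⁆ = ⁅x, y⁆ + ⁅x, z⁆ := by simp only [Ring.lie_def]; noncomm_ring
    exact h ▸ add_mem h₁ h₂
  | smul_left r x y _ _ h =>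
    have h' : ⁅r • x, y⁆ = r • ⁅x, y⁆ := by simp [Ring.lie_def, smul_sub]
    exact h' ▸ Submodule.smul_mem _ r h
  | smul_right r x y _ _ h =>
    have h' : ⁅x, r • y⁆ = r • ⁅x, y⁆ := by simp [Ring.lie_def, smul_sub]
    exact h' ▸ Submodule.smul_mem _ r h

/-- With `D = z^m∂_n`, `D' = z^{m'}∂_{n'}`,
`D'' = z^{m+m'}∂_{n''}` where `n'' = ⟨m',n⟩n' − ⟨m,n'⟩n`, and assuming `m, m' ≠ 0`,
`⟨m,n⟩ = 0`, `⟨m',n'⟩ = 0`: one has `⁅D,D'⁆ = D''` with `⟨m+m',n''⟩ = 0`; if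
`m + m' = 0` then `n'' = 0` and `⁅D,D'⁆ = 0`; and the `k`-submodule spanned by all
such derivations is closed under the bracket. -/
theorem bracket_closed_on_h
    (k : Type*) [CommRing k]
    (m m' : ℤ × ℤ) (n n' : (ℤ × ℤ) →ₗ[ℤ] ℤ)
    (hm : m ≠ 0) (hm' : m' ≠ 0) (hn : n m = 0) (hn' : n' m' = 0)
    (D D' D'' : Module.End k (AddMonoidAlgebra k (ℤ × ℤ)))
    (hD : ∀ x : ℤ × ℤ,
      D (AddMonoidAlgebra.single x 1) = AddMonoidAlgebra.single (m + x) ((n x : ℤ) : k))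
    (hD' : ∀ x : ℤ × ℤ,
      D' (AddMonoidAlgebra.single x 1) = AddMonoidAlgebra.single (m' + x) ((n' x : ℤ) : k))
    (hD'' : ∀ x : ℤ × ℤ,
      D'' (AddMonoidAlgebra.single x 1) =
        AddMonoidAlgebra.single (m + m' + x) (((n m' • n' - n' m • n) x : ℤ) : k)) :
    ⁅D, D'⁆ = D'' ∧
    (n m' • n' - n' m • n) (m + m') = 0 ∧
    (m + m' = 0 → (n m' • n' - n' m • n) = 0 ∧ ⁅D, D'⁆ = 0) ∧
    (∀ E E' : Module.End k (AddMonoidAlgebra k (ℤ × ℤ)),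
      E ∈ Submodule.span k (hamiltonianSet k) →
      E' ∈ Submodule.span k (hamiltonianSet k) →
      ⁅E, E'⁆ ∈ Submodule.span k (hamiltonianSet k)) := by
  refine ⟨end_ext_basis fun x => by rw [lie_apply_basis hD hD', hD''],
    bracket_covector_apply_add hn hn',
    fun h => ⟨bracket_covector_eq_zero hn hn' h, lie_eq_zero_of_add_eq_zero hn hn' hD hD' h⟩,
    fun E E' hE hE' =>
      lie_mem_span_of_forall_mem (fun _ hx _ hy => lie_mem_span_hamiltonianSet hx hy) hE hE'⟩
end
end

section
/- Let k be a field, R = k[t₁,t₂]/(t₁²,t₂²), and A the group algebra of ℤ² over R, with basis z^m for m ∈ ℤ². Let m₁, m₂ ∈ ℤ² be primitive vectors with m₁∧m₂ ≠ 0, let n₁, n₂ ∈ Hom(ℤ²,ℤ) be primitive with ⟨m₁,n₁⟩ = 0 and ⟨m₂,n₂⟩ = 0, let w₁, w₂ be positive integers and c₁, c₂ ∈ k. Define R-linear derivations ξᵢ of A by ξᵢ(z^m) = cᵢtᵢ⟨m,nᵢ⟩·z^{wᵢmᵢ+m}, and set θᵢ = id + ξᵢ. Then each θᵢ is an R-algebra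 automorphism of A (with inverse id − ξᵢ), and the commutator satisfies θ₂^{-1}∘θ₁^{-1}∘θ₂∘θ₁ = id + ξ, where ξ is the derivation ξ(z^m) = c₁c₂t₁t₂⟨m, w₁⟨m₁,n₂⟩n₁ − w₂⟨m₂,n₁⟩n₂⟩·z^{w₁m₁+w₂m₂+m}. -/
/-!
STATEMENT 5: The commutator computation underlying the basic scattering lemma:
over R = k[t₁,t₂]/(t₁²,t₂²) and A = R[ℤ²], with θᵢ = id + ξᵢ,
ξᵢ(z^m) = cᵢtᵢ⟨m,nᵢ⟩ z^{wᵢmᵢ+m}, one has θ₂⁻¹∘θ₁⁻¹∘θ₂∘θ₁ = id + ξ, where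
ξ(z^m) = c₁c₂t₁t₂⟨m, w₁⟨m₁,n₂⟩n₁ − w₂⟨m₂,n₁⟩n₂⟩ z^{w₁m₁+w₂m₂+m}.
-/

set_option synthInstance.maxHeartbeats 1000000
set_option maxHeartbeats 1000000

noncomputable section

/-- The ring `R = k[t₁,t₂]/(t₁²,t₂²)`. -/
abbrev Rquot (k : Type*) [Field k] : Type _ :=
  MvPolynomial (Fin 2) k ⧸
    Ideal.span {(MvPolynomial.X 0 : MvPolynomial (Fin 2) k) ^ 2,
      (MvPolynomial.X 1 : MvPolynomial (Fin 2) k) ^ 2}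

/-- The class of `tᵢ` in `R = k[t₁,t₂]/(t₁²,t₂²)`. -/
def tcl (k : Type*) [Field k] (i : Fin 2) : Rquot k :=
  Ideal.Quotient.mk _ (MvPolynomial.X i)

theorem AddMonoidAlgebra.linearMap_ext_single_one {R M N : Type*} [CommRing R] [AddCommGroup N]
    [Module R N] {f g : AddMonoidAlgebra R M →ₗ[R] N}
    (h : ∀ m, f (AddMonoidAlgebra.single m 1) = g (AddMonoidAlgebra.single m 1)) : f = g := by
  refine AddMonoidAlgebra.lhom_ext' fun m => LinearMap.ext_ring ?_
  simpa using h m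

/-- The linear endomorphism `z^m ↦ n(m) z^{v+m}` of the group algebra of `M` over `R`. -/
def AddMonoidAlgebra.monomialLinearMap (R : Type*) {M : Type*} [CommRing R] [AddCommGroup M]
    (v : M) (n : M →ₗ[ℤ] ℤ) : AddMonoidAlgebra R M →ₗ[R] AddMonoidAlgebra R M :=
  Finsupp.lsum R (fun m => AddMonoidAlgebra.lsingle (v + m) ∘ₗ
    LinearMap.mulLeft R ((n m : ℤ) : R)) ∘ₗ
    (AddMonoidAlgebra.coeffLinearEquiv R).toLinearMap

theorem AddMonoidAlgebra.monomialLinearMap_single {R M : Type*} [CommRing R] [AddCommGroup M]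
    (v : M) (n : M →ₗ[ℤ] ℤ) (m : M) (r : R) :
    monomialLinearMap R v n (single m r) = single (v + m) (((n m : ℤ) : R) * r) := by
  simp [monomialLinearMap]

/-- The derivation `z^m ↦ n(m) z^{v+m}` of the group algebra of `M` over `R`. -/
def AddMonoidAlgebra.monomialDerivation (R : Type*) {M : Type*} [CommRing R] [AddCommGroup M]
    (v : M) (n : M →ₗ[ℤ] ℤ) :
    Derivation R (AddMonoidAlgebra R M) (AddMonoidAlgebra R M) :=
  Derivation.mk' (monomialLinearMap R v n) <| by
    intro x y
    induction x using AddMonoidAlgebra.induction_linear with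
    | zero => simp
    | add x x' hx hx' => simp only [add_mul, map_add, hx, hx', smul_add, add_smul]; abel
    | single m r =>
      induction y using AddMonoidAlgebra.induction_linear with
      | zero => simp
      | add y y' hy hy' => simp only [mul_add, map_add, hy, hy', smul_add, add_smul]; abel
      | single m' r' =>
        simp only [single_mul_single, monomialLinearMap_single, smul_eq_mul]
        rw [show m + (v + m') = v + (m + m') by abel,
          show m' + (v + m) = v + (m + m') by abel, ← AddMonoidAlgebra.single_add]
        congr 1
        push_cast [map_add]
        ring

theorem AddMonoidAlgebra.monomialDerivation_single {R M : Type*} [CommRing R] [AddCommGroup M]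
    (v : M) (n : M →ₗ[ℤ] ℤ) (m : M) (r : R) :
    monomialDerivation R v n (single m r) = single (v + m) (((n m : ℤ) : R) * r) :=
  monomialLinearMap_single v n m r

/-- The automorphism `id + aD` attached to a derivation `D` and a scalar `a` with `a² = 0`;
its inverse is `id - aD`. -/
def Derivation.idAddSmulEquiv {R A : Type*} [CommRing R] [CommRing A] [Algebra R A]
    (D : Derivation R A A) (a : R) (ha : a * a = 0) : A ≃ₐ[R] A :=
  AlgEquiv.ofLinearEquiv
    (LinearEquiv.ofLinearMap
      (LinearMap.id + a • (D : A →ₗ[R] A)) (LinearMap.id - a • (D : A →ₗ[R] A))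
      (by
        ext x
        have h : a • a • D (D x) = 0 := by rw [smul_smul, ha, zero_smul]
        simp [smul_sub, h])
      (by ext x; simp [smul_smul, ha]))
    (by simp)
    (fun x y => by
      simp only [LinearEquiv.coe_ofLinearMap, LinearMap.add_apply, LinearMap.id_apply,
        LinearMap.smul_apply, Derivation.coeFn_coe, Derivation.leibniz, smul_eq_mul, add_mul,
        mul_add, smul_add, ha, zero_smul, mul_smul_comm, smul_mul_assoc, smul_smul,
        mul_comm y]
      abel)

theorem Derivation.idAddSmulEquiv_apply {R A : Type*} [CommRing R] [CommRing A] [Algebra R A]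
    (D : Derivation R A A) (a : R) (ha : a * a = 0) (x : A) :
    D.idAddSmulEquiv a ha x = x + a • D x := rfl

theorem Derivation.idAddSmulEquiv_symm_apply {R A : Type*} [CommRing R] [CommRing A]
    [Algebra R A] (D : Derivation R A A) (a : R) (ha : a * a = 0) (x : A) :
    (D.idAddSmulEquiv a ha).symm x = x - a • D x := rfl

theorem Derivation.idAddSmulEquiv_commutator {R A : Type*} [CommRing R] [CommRing A]
    [Algebra R A] (D E : Derivation R A A) (a b : R) (ha : a * a = 0) (hb : b * b = 0) (x : A) :
    (E.idAddSmulEquiv b hb).symm ((D.idAddSmulEquiv a ha).symm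
      (E.idAddSmulEquiv b hb (D.idAddSmulEquiv a ha x))) =
      x + (a * b) • (E (D x) - D (E x)) := by
  have hbab : b * (a * b) = 0 := by rw [mul_left_comm, hb, mul_zero]
  have haab : a * (a * b) = 0 := by rw [← mul_assoc, ha, zero_mul]
  simp only [idAddSmulEquiv_apply, idAddSmulEquiv_symm_apply, map_add, map_sub,
    Derivation.map_smul, map_zero, smul_sub, smul_smul, ha, hb, hbab, haab,
    zero_smul, mul_comm b a]
  abel

theorem tcl_mul_self (k : Type*) [Field k] (i : Fin 2) : tcl k i * tcl k i = 0 := by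
  rw [tcl, ← map_mul, ← pow_two, Ideal.Quotient.eq_zero_iff_mem]
  apply Ideal.subset_span
  fin_cases i <;> simp

theorem commutator_of_nilpotent_generators
    (k : Type*) [Field k]
    (m₁ m₂ : ℤ × ℤ)
    (hm₁ : IsCoprime m₁.1 m₁.2) (hm₂ : IsCoprime m₂.1 m₂.2)
    (hwedge : m₁.1 * m₂.2 - m₁.2 * m₂.1 ≠ 0)
    (n₁ n₂ : (ℤ × ℤ) →ₗ[ℤ] ℤ)
    (hn₁prim : IsCoprime (n₁ (1, 0)) (n₁ (0, 1)))
    (hn₂prim : IsCoprime (n₂ (1, 0)) (n₂ (0, 1)))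
    (hn₁ : n₁ m₁ = 0) (hn₂ : n₂ m₂ = 0)
    (w₁ w₂ : ℕ) (hw₁ : 0 < w₁) (hw₂ : 0 < w₂)
    (c₁ c₂ : k)
    (ξ₁ ξ₂ ξ : Module.End (Rquot k) (AddMonoidAlgebra (Rquot k) (ℤ × ℤ)))
    (hξ₁ : ∀ m : ℤ × ℤ,
      ξ₁ (AddMonoidAlgebra.single m 1) =
        AddMonoidAlgebra.single ((w₁ : ℤ) • m₁ + m)
          (algebraMap k (Rquot k) c₁ * tcl k 0 * ((n₁ m : ℤ) : Rquot k)))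
    (hξ₂ : ∀ m : ℤ × ℤ,
      ξ₂ (AddMonoidAlgebra.single m 1) =
        AddMonoidAlgebra.single ((w₂ : ℤ) • m₂ + m)
          (algebraMap k (Rquot k) c₂ * tcl k 1 * ((n₂ m : ℤ) : Rquot k)))
    (hξ : ∀ m : ℤ × ℤ,
      ξ (AddMonoidAlgebra.single m 1) =
        AddMonoidAlgebra.single ((w₁ : ℤ) • m₁ + (w₂ : ℤ) • m₂ + m)
          (algebraMap k (Rquot k) c₁ * algebraMap k (Rquot k) c₂ *
            tcl k 0 * tcl k 1 *
            (((((w₁ : ℤ) * n₂ m₁) • n₁ - ((w₂ : ℤ) * n₁ m₂) • n₂) m : ℤ) : Rquot k))) :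
    ∃ Θ₁ Θ₂ : AddMonoidAlgebra (Rquot k) (ℤ × ℤ) ≃ₐ[Rquot k]
        AddMonoidAlgebra (Rquot k) (ℤ × ℤ),
      (∀ x, Θ₁ x = x + ξ₁ x) ∧ (∀ x, Θ₁.symm x = x - ξ₁ x) ∧
      (∀ x, Θ₂ x = x + ξ₂ x) ∧ (∀ x, Θ₂.symm x = x - ξ₂ x) ∧
      (∀ x, Θ₂.symm (Θ₁.symm (Θ₂ (Θ₁ x))) = x + ξ x) := by
  set a : Rquot k := algebraMap k (Rquot k) c₁ * tcl k 0
  set b : Rquot k := algebraMap k (Rquot k) c₂ * tcl k 1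
  have ha : a * a = 0 := by rw [mul_mul_mul_comm, tcl_mul_self, mul_zero]
  have hb : b * b = 0 := by rw [mul_mul_mul_comm, tcl_mul_self, mul_zero]
  let D := AddMonoidAlgebra.monomialDerivation (Rquot k) ((w₁ : ℤ) • m₁) n₁
  let E := AddMonoidAlgebra.monomialDerivation (Rquot k) ((w₂ : ℤ) • m₂) n₂
  have hD : ξ₁ = a • D.toLinearMap :=
    AddMonoidAlgebra.linearMap_ext_single_one fun m => by
      simp [hξ₁, D, AddMonoidAlgebra.monomialDerivation_single]
  have hE : ξ₂ = b • E.toLinearMap :=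
    AddMonoidAlgebra.linearMap_ext_single_one fun m => by
      simp [hξ₂, E, AddMonoidAlgebra.monomialDerivation_single]
  have hDE : ξ = (a * b) • (E.toLinearMap ∘ₗ D.toLinearMap - D.toLinearMap ∘ₗ E.toLinearMap) :=
    AddMonoidAlgebra.linearMap_ext_single_one fun m => by
      simp only [hξ, D, E, LinearMap.smul_apply, LinearMap.sub_apply, LinearMap.comp_apply,
        Derivation.coeFn_coe, AddMonoidAlgebra.monomialDerivation_single]
      rw [show (w₂ : ℤ) • m₂ + ((w₁ : ℤ) • m₁ + m) = (w₁ : ℤ) • m₁ + (w₂ : ℤ) • m₂ + m by abel,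
        ← add_assoc ((w₁ : ℤ) • m₁), ← AddMonoidAlgebra.single_sub,
        AddMonoidAlgebra.smul_single]
      congr 1
      simp only [map_add, map_smul, smul_eq_mul, a, b]
      push_cast
      ring
  refine ⟨D.idAddSmulEquiv a ha, E.idAddSmulEquiv b hb, fun x => ?_, fun x => ?_, fun x => ?_,
    fun x => ?_, fun x => ?_⟩
  · rw [hD]; rfl
  · rw [hD]; rfl
  · rw [hE]; rfl
  · rw [hE]; rfl
  · rw [hDE]; exact D.idAddSmulEquiv_commutator E a b ha hb x
end
end
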